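/- There exists a constant c ≥ 1 such that for all integers 0 ≤ n ≤ m one has c⁻¹·𝓡_n·𝓡̄_{m−n} ≤ 𝓡_m ≤ c·𝓡_n·𝓡_{m−n}. (Weak multiplicative estimate; Corollary 3.5 of the paper in the planar case.) -/

import Mathlib

open Finset
open scoped Classical

namespace Carpet

/-- The contraction map `Ψ_{(a,b)}(x,y) = ((x+a)/L, (y+b)/L)`. -/
noncomputable def Psi (L : ℕ) (p : ℕ × ℕ) (x : ℝ × ℝ) : ℝ × ℝ :=
  ((x.1 + p.1) / L, (x.2 + p.2) / L)

/-- Words of length `n` over the alphabet `A`. -/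
abbrev Word (A : Finset (ℕ × ℕ)) (n : ℕ) := Fin n → {p : ℕ × ℕ // p ∈ A}

/-- `Ψ_w = Ψ_{w₁} ∘ ⋯ ∘ Ψ_{w_n}`. -/
noncomputable def PsiW (L : ℕ) {A : Finset (ℕ × ℕ)} {n : ℕ} (w : Word A n) : ℝ × ℝ → ℝ × ℝ :=
  (List.ofFn fun i => Psi L (w i).1).foldr (· ∘ ·) id

/-- The four corners of the unit square. -/
noncomputable def V0 : Finset (ℝ × ℝ) :=
  {((0 : ℝ), (0 : ℝ)), ((1 : ℝ), (0 : ℝ)), ((1 : ℝ), (1 : ℝ)), ((0 : ℝ), (1 : ℝ))}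

/-- The level-`n` vertex set `V_n = ⋃_{w ∈ W_n} Ψ_w(V₀)`. -/
noncomputable def VN (L : ℕ) (A : Finset (ℕ × ℕ)) (n : ℕ) : Finset (ℝ × ℝ) :=
  (Finset.univ : Finset (Word A n)).biUnion fun w => V0.image (PsiW L w)

/-- Euclidean distance in the plane. -/
noncomputable def eudist (x y : ℝ × ℝ) : ℝ :=
  Real.sqrt ((x.1 - y.1) ^ 2 + (x.2 - y.2) ^ 2)

/-- `n`-adjacency: `x = Ψ_w(p)`, `y = Ψ_w(q)` with `p, q ∈ V₀`, `|p - q| = 1`. -/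
def Adj (L : ℕ) (A : Finset (ℕ × ℕ)) (n : ℕ) (x y : ℝ × ℝ) : Prop :=
  ∃ w : Word A n, ∃ p ∈ V0, ∃ q ∈ V0,
    eudist p q = 1 ∧ x = PsiW L w p ∧ y = PsiW L w q

/-- The natural graph energy `D_n(f) = Σ_{x ∼ y} (f x - f y)²`
(summing over ordered pairs and halving). -/
noncomputable def Dform (L : ℕ) (A : Finset (ℕ × ℕ)) (n : ℕ) (f : ℝ × ℝ → ℝ) : ℝ :=
  (1 / 2) * ∑ x ∈ VN L A n, ∑ y ∈ VN L A n,
    (if Adj L A n x y then (f x - f y) ^ 2 else 0)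

/-- The effective resistance between `S` and `T` in the level-`n` graph. -/
noncomputable def EffRes (L : ℕ) (A : Finset (ℕ × ℕ)) (n : ℕ) (S T : Set (ℝ × ℝ)) : ℝ :=
  (sInf {e : ℝ | ∃ f : ℝ × ℝ → ℝ,
      (∀ x ∈ S, f x = 1) ∧ (∀ x ∈ T, f x = 0) ∧ e = Dform L A n f})⁻¹

/-- `𝓡_n`, the resistance between the corners `(0,0)` and `(1,0)`. -/
noncomputable def RR (L : ℕ) (A : Finset (ℕ × ℕ)) (n : ℕ) : ℝ :=
  EffRes L A n {((0 : ℝ), (0 : ℝ))} {((1 : ℝ), (0 : ℝ))}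

/-- `𝓡̄_n`, the resistance between the left and right sides of the unit square. -/
noncomputable def RRbar (L : ℕ) (A : Finset (ℕ × ℕ)) (n : ℕ) : ℝ :=
  EffRes L A n
    ((VN L A n : Set (ℝ × ℝ)) ∩ ({(0 : ℝ)} ×ˢ Set.Icc (0 : ℝ) 1))
    ((VN L A n : Set (ℝ × ℝ)) ∩ ({(1 : ℝ)} ×ˢ Set.Icc (0 : ℝ) 1))

/-- The standing assumptions on `(L, A)` defining a generalized Sierpiński carpet. -/
structure GoodCarpet (L : ℕ) (A : Finset (ℕ × ℕ)) : Prop where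
  three_le : 3 ≤ L
  mem_lt : ∀ p ∈ A, p.1 < L ∧ p.2 < L
  symm_swap : ∀ a b : ℕ, (a, b) ∈ A → (b, a) ∈ A
  symm_reflect : ∀ a b : ℕ, (a, b) ∈ A → (L - 1 - a, b) ∈ A
  connected : IsConnected
    (⋃ p ∈ A, Set.Icc (((p.1 : ℝ) / L, (p.2 : ℝ) / L) : ℝ × ℝ)
      ((((p.1 : ℝ) + 1) / L, ((p.2 : ℝ) + 1) / L) : ℝ × ℝ))
  flat_border : ∀ a b : ℕ, a < L → b < L →
    (a = 0 ∨ a = L - 1 ∨ b = 0 ∨ b = L - 1) → (a, b) ∈ A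
  proper : ∃ a b : ℕ, a < L ∧ b < L ∧ (a, b) ∉ A

/-- The generalized Sierpiński carpet `F`. -/
def carpetF (L : ℕ) (A : Finset (ℕ × ℕ)) : Set (ℝ × ℝ) :=
  ⋂ n : ℕ, ⋃ w : Word A n, PsiW L w '' Set.Icc (((0 : ℝ), (0 : ℝ)) : ℝ × ℝ) ((1 : ℝ), (1 : ℝ))


/-- Single-cell energy. -/
noncomputable def e0 (f : ℝ × ℝ → ℝ) : ℝ :=
  2 * ((f (0,0) - f (1,0)) ^ 2 + (f (1,0) - f (1,1)) ^ 2 + (f (1,1) - f (0,1)) ^ 2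
    + (f (0,1) - f (0,0)) ^ 2)

/-- Recursive energy, with multiplicity. -/
noncomputable def EE (L : ℕ) (A : Finset (ℕ × ℕ)) : ℕ → (ℝ × ℝ → ℝ) → ℝ
  | 0, f => e0 f
  | n + 1, f => ∑ a ∈ A, EE L A n (f ∘ Psi L a)

lemma e0_nonneg (f : ℝ × ℝ → ℝ) : 0 ≤ e0 f := by
  unfold e0; positivity

lemma EE_nonneg (L : ℕ) (A : Finset (ℕ × ℕ)) (n : ℕ) (f : ℝ × ℝ → ℝ) : 0 ≤ EE L A n f := by
  induction n generalizing f with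
  | zero => exact e0_nonneg f
  | succ n ih => exact Finset.sum_nonneg fun a _ => ih _

lemma e0_eq (f : ℝ × ℝ → ℝ) :
    ∑ p ∈ V0, ∑ q ∈ V0, (if eudist p q = 1 then (f p - f q) ^ 2 else 0) = e0 f := by
  have h2 : Real.sqrt 2 ≠ 1 := by
    intro hh
    have := Real.sq_sqrt (show (0:ℝ) ≤ 2 by norm_num)
    rw [hh] at this; norm_num at this
  have h2' : ((1:ℝ) + 1) = 2 := by norm_num
  unfold V0 e0
  simp [Finset.sum_insert, eudist, h2, h2']
  ring

lemma PsiW_zero (L : ℕ) {A : Finset (ℕ × ℕ)} (w : Word A 0) : PsiW L w = id := by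
  simp [PsiW]

lemma PsiW_cons (L : ℕ) {A : Finset (ℕ × ℕ)} {n : ℕ} (a : {p : ℕ × ℕ // p ∈ A}) (w : Word A n) :
    PsiW L (Fin.cons a w : Word A (n+1)) = Psi L a.1 ∘ PsiW L w := by
  simp [PsiW, List.ofFn_succ]

lemma EE_eq (L : ℕ) (A : Finset (ℕ × ℕ)) (n : ℕ) (f : ℝ × ℝ → ℝ) :
    EE L A n f = ∑ w : Word A n, e0 (f ∘ PsiW L w) := by
  induction n generalizing f with
  | zero => simp [EE, PsiW_zero]
  | succ n ih =>
    rw [EE, ← (Fin.consEquiv fun _ : Fin (n+1) => {p : ℕ × ℕ // p ∈ A}).sum_comp,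
      Fintype.sum_prod_type, ← Finset.sum_coe_sort A]
    refine Finset.sum_congr rfl fun a _ => ?_
    rw [ih]
    refine Finset.sum_congr rfl fun w _ => ?_
    show _ = e0 (f ∘ PsiW L (Fin.cons a w : Word A (n+1)))
    rw [PsiW_cons]; rfl

lemma PsiW_affine (L : ℕ) {A : Finset (ℕ × ℕ)} {n : ℕ} (w : Word A n) (p : ℝ × ℝ) :
    PsiW L w p = PsiW L w (0,0) + (p.1 / L ^ n, p.2 / L ^ n) := by
  induction n with
  | zero => simp [PsiW_zero]
  | succ n ih =>
    rw [← Fin.cons_self_tail w, PsiW_cons]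
    simp only [Function.comp]
    rw [ih]
    ext <;> simp [Psi] <;> ring

lemma Psi_mem_Ico {L : ℕ} {A : Finset (ℕ × ℕ)} (h : GoodCarpet L A) (a : ℕ × ℕ) (ha : a ∈ A)
    (x : ℝ × ℝ) (h1 : 0 ≤ x.1 ∧ x.1 < 1) (h2 : 0 ≤ x.2 ∧ x.2 < 1) :
    (0 ≤ (Psi L a x).1 ∧ (Psi L a x).1 < 1) ∧ (0 ≤ (Psi L a x).2 ∧ (Psi L a x).2 < 1) := by
  have hL : (0:ℝ) < L := by
    have := h.three_le
    exact_mod_cast (by omega : 0 < L)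
  have g1 : (a.1 : ℝ) + 1 ≤ L := by exact_mod_cast (h.mem_lt a ha).1
  have g2 : (a.2 : ℝ) + 1 ≤ L := by exact_mod_cast (h.mem_lt a ha).2
  have n1 : (0:ℝ) ≤ a.1 := Nat.cast_nonneg _
  have n2 : (0:ℝ) ≤ a.2 := Nat.cast_nonneg _
  simp only [Psi]
  refine ⟨⟨by apply div_nonneg <;> linarith, ?_⟩, ⟨by apply div_nonneg <;> linarith, ?_⟩⟩ <;>
  · rw [div_lt_one hL]; linarith

lemma PsiW_mem_Ico {L : ℕ} {A : Finset (ℕ × ℕ)} (h : GoodCarpet L A) {n : ℕ} (w : Word A n) :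
    (0 ≤ (PsiW L w (0,0)).1 ∧ (PsiW L w (0,0)).1 < 1) ∧
    (0 ≤ (PsiW L w (0,0)).2 ∧ (PsiW L w (0,0)).2 < 1) := by
  induction n with
  | zero => simp [PsiW_zero]
  | succ n ih =>
    rw [← Fin.cons_self_tail w, PsiW_cons]
    exact Psi_mem_Ico h _ (w 0).2 _ (ih _).1 (ih _).2

lemma nat_add_inj {a b : ℕ} {x y : ℝ} (hx : 0 ≤ x ∧ x < 1) (hy : 0 ≤ y ∧ y < 1)
    (hh : x + a = y + b) : a = b ∧ x = y := by
  have h1 : (a:ℝ) < b + 1 := by linarith [hx.1, hy.2]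
  have h2 : (b:ℝ) < a + 1 := by linarith [hx.2, hy.1]
  have h1' : a < b + 1 := by exact_mod_cast h1
  have h2' : b < a + 1 := by exact_mod_cast h2
  have : a = b := by omega
  subst this
  exact ⟨rfl, by linarith⟩

lemma PsiW_inj {L : ℕ} {A : Finset (ℕ × ℕ)} (h : GoodCarpet L A) {n : ℕ} (w w' : Word A n)
    (hw : PsiW L w (0,0) = PsiW L w' (0,0)) : w = w' := by
  have hL : (L:ℝ) ≠ 0 := by
    have := h.three_le
    exact_mod_cast (by omega : L ≠ 0)
  induction n with
  | zero => exact Subsingleton.elim _ _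
  | succ n ih =>
    rw [← Fin.cons_self_tail w, ← Fin.cons_self_tail w', PsiW_cons, PsiW_cons] at hw
    have k1 := PsiW_mem_Ico h (Fin.tail w)
    have k2 := PsiW_mem_Ico h (Fin.tail w')
    simp only [Function.comp, Psi, Prod.mk.injEq, div_left_inj' hL] at hw
    obtain ⟨a1, a2⟩ := nat_add_inj k1.1 k2.1 hw.1
    obtain ⟨b1, b2⟩ := nat_add_inj k1.2 k2.2 hw.2
    have := ih _ _ (Prod.ext a2 b2)
    rw [← Fin.cons_self_tail w, ← Fin.cons_self_tail w', this]
    congr 1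
    exact Subtype.ext (Prod.ext a1 b1)

/-- Comparison of the two energies. -/
lemma D_le_E_aux {L : ℕ} {A : Finset (ℕ × ℕ)} (h : GoodCarpet L A) (n : ℕ) (f : ℝ × ℝ → ℝ) :
    Dform L A n f ≤ EE L A n f ∧ EE L A n f ≤ 32 * Dform L A n f := by
  set T : Finset (Word A n × (ℝ × ℝ) × (ℝ × ℝ)) :=
    ((Finset.univ : Finset (Word A n)) ×ˢ (V0 ×ˢ V0)).filter (fun t => eudist t.2.1 t.2.2 = 1)
    with hT
  set g : Word A n × (ℝ × ℝ) × (ℝ × ℝ) → (ℝ × ℝ) × (ℝ × ℝ) :=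
    fun t => (PsiW L t.1 t.2.1, PsiW L t.1 t.2.2) with hg
  set F : (ℝ × ℝ) × (ℝ × ℝ) → ℝ := fun z => (f z.1 - f z.2) ^ 2 with hF
  have hE : EE L A n f = ∑ t ∈ T, F (g t) := by
    rw [EE_eq, hT, Finset.sum_filter, Finset.sum_product]
    refine Finset.sum_congr rfl fun w _ => ?_
    rw [← e0_eq, Finset.sum_product]
    rfl
  have himg : ((VN L A n) ×ˢ (VN L A n)).filter (fun z => Adj L A n z.1 z.2) = T.image g := by
    ext ⟨x, y⟩
    simp only [Finset.mem_filter, Finset.mem_product, Finset.mem_image, VN, Finset.mem_biUnion, hT,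
      hg, Adj, Finset.mem_univ, true_and, Prod.exists, Prod.mk.injEq]
    constructor
    · rintro ⟨-, w, p1, p2, hp, q1, q2, hq, hd, rfl, rfl⟩
      exact ⟨w, p1, p2, q1, q2, ⟨⟨hp, hq⟩, hd⟩, rfl, rfl⟩
    · rintro ⟨w, p1, p2, q1, q2, ⟨⟨hp, hq⟩, hd⟩, rfl, rfl⟩
      exact ⟨⟨⟨w, p1, p2, hp, rfl⟩, ⟨w, q1, q2, hq, rfl⟩⟩, w, _, _, hp, _, _, hq, hd, rfl, rfl⟩
  have hD : 2 * Dform L A n f = ∑ z ∈ T.image g, F z := by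
    rw [← himg, Finset.sum_filter, Finset.sum_product, Dform]
    ring
  rw [Finset.sum_comp] at hE
  have hFn : ∀ z, 0 ≤ F z := fun z => sq_nonneg _
  have hlow : ∑ z ∈ T.image g, F z ≤ EE L A n f := by
    rw [hE]
    refine Finset.sum_le_sum fun z hz => ?_
    rw [nsmul_eq_mul]
    have : 1 ≤ #{t ∈ T | g t = z} := by
      rw [Nat.one_le_iff_ne_zero, Finset.card_ne_zero]
      obtain ⟨t, ht, rfl⟩ := Finset.mem_image.1 hz
      exact ⟨t, by simp [ht]⟩
    have : (1:ℝ) ≤ #{t ∈ T | g t = z} := by exact_mod_cast this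
    nlinarith [hFn z]
  have hup : EE L A n f ≤ 16 * ∑ z ∈ T.image g, F z := by
    rw [hE, Finset.mul_sum]
    refine Finset.sum_le_sum fun z hz => ?_
    rw [nsmul_eq_mul]
    have : #{t ∈ T | g t = z} ≤ 16 := by
      have h1 : #{t ∈ T | g t = z} ≤ #(V0 ×ˢ V0) := by
        refine Finset.card_le_card_of_injOn (fun t => t.2) ?_ ?_
        · intro t ht
          simp only [hT, Finset.coe_filter, Finset.mem_filter, Finset.mem_product,
            Set.mem_ofPred_eq] at ht
          simpa using ht.1.1.2
        · rintro ⟨w, p, q⟩ ht ⟨w', p', q'⟩ ht' hh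
          simp only [Prod.mk.injEq] at hh
          obtain ⟨rfl, rfl⟩ := hh
          simp only [Finset.coe_filter, Set.mem_ofPred_eq] at ht ht'
          have h3 := congrArg Prod.fst (ht.2.trans ht'.2.symm)
          simp only [hg] at h3
          rw [PsiW_affine L w, PsiW_affine L w'] at h3
          rw [PsiW_inj h w w' (add_right_cancel h3)]
      have h2 : #V0 ≤ 4 := by
        unfold V0
        exact Finset.card_le_four
      rw [Finset.card_product] at h1
      nlinarith
    have : ((#{t ∈ T | g t = z} : ℕ) : ℝ) ≤ 16 := by exact_mod_cast this
    nlinarith [hFn z]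
  have hnn : 0 ≤ ∑ z ∈ T.image g, F z := Finset.sum_nonneg fun z _ => hFn z
  constructor <;> linarith

lemma D_le_E {L : ℕ} {A : Finset (ℕ × ℕ)} (h : GoodCarpet L A) (n : ℕ) (f : ℝ × ℝ → ℝ) :
    Dform L A n f ≤ EE L A n f := (D_le_E_aux h n f).1

lemma E_le_D {L : ℕ} {A : Finset (ℕ × ℕ)} (h : GoodCarpet L A) (n : ℕ) (f : ℝ × ℝ → ℝ) :
    EE L A n f ≤ 32 * Dform L A n f := (D_le_E_aux h n f).2

lemma D_nonneg (L : ℕ) (A : Finset (ℕ × ℕ)) (n : ℕ) (f : ℝ × ℝ → ℝ) : 0 ≤ Dform L A n f := by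
  unfold Dform
  refine mul_nonneg (by norm_num) (Finset.sum_nonneg fun x _ => Finset.sum_nonneg fun y _ => ?_)
  split_ifs
  · positivity
  · exact le_rfl

lemma D_congr (L : ℕ) (A : Finset (ℕ × ℕ)) (n : ℕ) (f g : ℝ × ℝ → ℝ)
    (hfg : ∀ x ∈ VN L A n, f x = g x) : Dform L A n f = Dform L A n g := by
  unfold Dform
  congr 1
  refine Finset.sum_congr rfl fun x hx => Finset.sum_congr rfl fun y hy => ?_
  rw [hfg x hx, hfg y hy]

/-- Closed unit square. -/
def Sq : Set (ℝ × ℝ) := {x | (0 ≤ x.1 ∧ x.1 ≤ 1) ∧ (0 ≤ x.2 ∧ x.2 ≤ 1)}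

lemma Psi_mem_Sq {L : ℕ} {A : Finset (ℕ × ℕ)} (h : GoodCarpet L A) (a : ℕ × ℕ) (ha : a ∈ A)
    (x : ℝ × ℝ) (hx : x ∈ Sq) : Psi L a x ∈ Sq := by
  have hL : (0:ℝ) < L := by
    have := h.three_le
    exact_mod_cast (by omega : 0 < L)
  have g1 : (a.1 : ℝ) + 1 ≤ L := by exact_mod_cast (h.mem_lt a ha).1
  have g2 : (a.2 : ℝ) + 1 ≤ L := by exact_mod_cast (h.mem_lt a ha).2
  have n1 : (0:ℝ) ≤ a.1 := Nat.cast_nonneg _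
  have n2 : (0:ℝ) ≤ a.2 := Nat.cast_nonneg _
  obtain ⟨⟨h1, h2⟩, ⟨h3, h4⟩⟩ := hx
  simp only [Psi, Sq, Set.mem_ofPred_eq]
  refine ⟨⟨by apply div_nonneg <;> linarith, ?_⟩, ⟨by apply div_nonneg <;> linarith, ?_⟩⟩ <;>
  · rw [div_le_one hL]; linarith

lemma V0_sub_Sq (p : ℝ × ℝ) (hp : p ∈ V0) : p ∈ Sq := by
  simp only [V0, Finset.mem_insert, Finset.mem_singleton] at hp
  rcases hp with rfl | rfl | rfl | rfl <;> simp [Sq]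

lemma VN_sub_Sq {L : ℕ} {A : Finset (ℕ × ℕ)} (h : GoodCarpet L A) (n : ℕ) (x : ℝ × ℝ)
    (hx : x ∈ VN L A n) : x ∈ Sq := by
  have key : ∀ (n : ℕ) (w : Word A n) (p : ℝ × ℝ), p ∈ Sq → PsiW L w p ∈ Sq := by
    intro n
    induction n with
    | zero => intro w p hp; simpa [PsiW_zero] using hp
    | succ n ih =>
      intro w p hp
      rw [← Fin.cons_self_tail w, PsiW_cons]
      exact Psi_mem_Sq h _ (w 0).2 _ (ih _ _ hp)
  simp only [VN, Finset.mem_biUnion, Finset.mem_univ, true_and, Finset.mem_image] at hx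
  obtain ⟨w, p, hp, rfl⟩ := hx
  exact key n w p (V0_sub_Sq p hp)

/-- Pointwise domination implies domination of energies. -/
lemma EE_dom {L : ℕ} {A : Finset (ℕ × ℕ)} (h : GoodCarpet L A) (M : ℝ) (k : ℕ)
    (u v v' : ℝ × ℝ → ℝ)
    (hu : ∀ x ∈ Sq, ∀ y ∈ Sq, (u x - u y) ^ 2 ≤ M * ((v x - v y) ^ 2 + (v' x - v' y) ^ 2)) :
    EE L A k u ≤ M * (EE L A k v + EE L A k v') := by
  induction k generalizing u v v' with
  | zero =>
    have m00 : ((0:ℝ), (0:ℝ)) ∈ Sq := by simp [Sq]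
    have m10 : ((1:ℝ), (0:ℝ)) ∈ Sq := by simp [Sq]
    have m11 : ((1:ℝ), (1:ℝ)) ∈ Sq := by simp [Sq]
    have m01 : ((0:ℝ), (1:ℝ)) ∈ Sq := by simp [Sq]
    have := hu _ m00 _ m10
    have := hu _ m10 _ m11
    have := hu _ m11 _ m01
    have := hu _ m01 _ m00
    simp only [EE, e0]
    linarith
  | succ k ih =>
    simp only [EE]
    rw [← Finset.sum_add_distrib, Finset.mul_sum]
    refine Finset.sum_le_sum fun a ha => ih _ _ _ fun x hx y hy => ?_
    exact hu _ (Psi_mem_Sq h a ha x hx) _ (Psi_mem_Sq h a ha y hy)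

lemma EE_swap {L : ℕ} {A : Finset (ℕ × ℕ)} (h : GoodCarpet L A) (k : ℕ) (f : ℝ × ℝ → ℝ) :
    EE L A k (f ∘ Prod.swap) = EE L A k f := by
  induction k generalizing f with
  | zero => simp only [EE, e0, Function.comp, Prod.swap]; ring
  | succ k ih =>
    simp only [EE]
    refine Finset.sum_bij' (fun a _ => a.swap) (fun a _ => a.swap)
      (fun a ha => h.symm_swap _ _ ha) (fun a ha => h.symm_swap _ _ ha) (by simp) (by simp) ?_
    intro a ha
    rw [← ih]
    rfl

/-- Reflection in the first coordinate. -/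
def refl1 (x : ℝ × ℝ) : ℝ × ℝ := (1 - x.1, x.2)

lemma EE_refl1 {L : ℕ} {A : Finset (ℕ × ℕ)} (h : GoodCarpet L A) (k : ℕ) (f : ℝ × ℝ → ℝ) :
    EE L A k (f ∘ refl1) = EE L A k f := by
  have hL3 := h.three_le
  have hL : (L:ℝ) ≠ 0 := by exact_mod_cast (by omega : L ≠ 0)
  induction k generalizing f with
  | zero => simp only [EE, e0, Function.comp, refl1]; norm_num; ring
  | succ k ih =>
    simp only [EE]
    refine Finset.sum_bij' (fun a _ => (L - 1 - a.1, a.2)) (fun a _ => (L - 1 - a.1, a.2))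
      (fun a ha => h.symm_reflect _ _ ha) (fun a ha => h.symm_reflect _ _ ha) ?_ ?_ ?_
    · intro a ha
      have := (h.mem_lt a ha).1
      ext <;> simp; omega
    · intro a ha
      have := (h.mem_lt a ha).1
      ext <;> simp; omega
    intro a ha
    rw [← ih]
    congr 1
    funext x
    simp only [Function.comp, refl1, Psi]
    congr 2
    have h1 : a.1 + 1 ≤ L := (h.mem_lt a ha).1
    have : ((L - 1 - a.1 : ℕ) : ℝ) = L - 1 - a.1 := by
      rw [Nat.sub_sub, Nat.cast_sub (by omega)]; push_cast; ring
    rw [this]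
    field_simp
    ring

/-- Reflection in the second coordinate. -/
def refl2 (x : ℝ × ℝ) : ℝ × ℝ := (x.1, 1 - x.2)

lemma EE_refl2 {L : ℕ} {A : Finset (ℕ × ℕ)} (h : GoodCarpet L A) (k : ℕ) (f : ℝ × ℝ → ℝ) :
    EE L A k (f ∘ refl2) = EE L A k f := by
  rw [← EE_swap h k f, ← EE_refl1 h k (f ∘ Prod.swap), ← EE_swap h k]
  rfl

/-- Extended conductance between the corners. -/
noncomputable def cc (L : ℕ) (A : Finset (ℕ × ℕ)) (n : ℕ) (S T : Set (ℝ × ℝ)) : ℝ :=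
  sInf {e : ℝ | ∃ f : ℝ × ℝ → ℝ,
      (∀ x ∈ S, f x = 1) ∧ (∀ x ∈ T, f x = 0) ∧ e = Dform L A n f}

lemma cc_le (L : ℕ) (A : Finset (ℕ × ℕ)) (n : ℕ) (S T : Set (ℝ × ℝ)) (f : ℝ × ℝ → ℝ)
    (h1 : ∀ x ∈ S, f x = 1) (h2 : ∀ x ∈ T, f x = 0) : cc L A n S T ≤ Dform L A n f := by
  refine csInf_le ⟨0, ?_⟩ ⟨f, h1, h2, rfl⟩
  rintro _ ⟨g, -, -, rfl⟩
  exact D_nonneg _ _ _ _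

lemma le_cc (L : ℕ) (A : Finset (ℕ × ℕ)) (n : ℕ) (S T : Set (ℝ × ℝ)) (hd : Disjoint S T) (b : ℝ)
    (hb : ∀ f : ℝ × ℝ → ℝ, (∀ x ∈ S, f x = 1) → (∀ x ∈ T, f x = 0) → b ≤ Dform L A n f) :
    b ≤ cc L A n S T := by
  refine le_csInf ⟨_, fun x => if x ∈ S then 1 else 0, ?_, ?_, rfl⟩ ?_
  · intro x hx; simp [hx]
  · intro x hx; simp [Set.disjoint_right.1 hd hx]
  · rintro _ ⟨f, h1, h2, rfl⟩
    exact hb f h1 h2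

/-- Corner conductance. -/
noncomputable def cp (L : ℕ) (A : Finset (ℕ × ℕ)) (n : ℕ) : ℝ :=
  cc L A n {((0 : ℝ), (0 : ℝ))} {((1 : ℝ), (0 : ℝ))}

/-- Side conductance. -/
noncomputable def cb (L : ℕ) (A : Finset (ℕ × ℕ)) (n : ℕ) : ℝ :=
  cc L A n
    ((VN L A n : Set (ℝ × ℝ)) ∩ ({(0 : ℝ)} ×ˢ Set.Icc (0 : ℝ) 1))
    ((VN L A n : Set (ℝ × ℝ)) ∩ ({(1 : ℝ)} ×ˢ Set.Icc (0 : ℝ) 1))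

lemma disj1 : Disjoint ({((0 : ℝ), (0 : ℝ))} : Set (ℝ × ℝ)) {((1 : ℝ), (0 : ℝ))} := by simp

lemma disj2 (V : Set (ℝ × ℝ)) : Disjoint (V ∩ ({(0 : ℝ)} ×ˢ Set.Icc (0 : ℝ) 1))
    (V ∩ ({(1 : ℝ)} ×ˢ Set.Icc (0 : ℝ) 1)) := by
  rw [Set.disjoint_left]
  rintro ⟨x, y⟩ ⟨-, h1⟩ ⟨-, h2⟩
  simp at h1 h2
  linarith [h1.1, h2.1]

/-- Lower bound along the bottom path. -/
lemma EE_path {L : ℕ} {A : Finset (ℕ × ℕ)} (h : GoodCarpet L A) (n : ℕ) (f : ℝ × ℝ → ℝ) :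
    (f (0,0) - f (1,0)) ^ 2 ≤ (L:ℝ) ^ n * EE L A n f := by
  have hL3 := h.three_le
  have hL : (L:ℝ) ≠ 0 := by exact_mod_cast (by omega : L ≠ 0)
  induction n generalizing f with
  | zero =>
    simp only [EE, e0, pow_zero, one_mul]
    nlinarith [sq_nonneg (f (0,0) - f (1,0)), sq_nonneg (f (1,0) - f (1,1)),
      sq_nonneg (f (1,1) - f (0,1)), sq_nonneg (f (0,1) - f (0,0))]
  | succ n ih =>
    have h1 : f (0,0) - f (1,0) =
        ∑ i ∈ Finset.range L, (f ((i:ℝ) / L, 0) - f (((i + 1 : ℕ):ℝ) / L, 0)) := by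
      rw [Finset.sum_range_sub' (fun i : ℕ => f ((i:ℝ) / L, 0))]
      simp [hL]
    have h2 : ∀ i ∈ Finset.range L, (f ((i:ℝ) / L, 0) - f (((i + 1 : ℕ):ℝ) / L, 0)) ^ 2 ≤
        (L:ℝ) ^ n * EE L A n (f ∘ Psi L (i, 0)) := by
      intro i _
      have := ih (f ∘ Psi L (i, 0))
      simp only [Function.comp, Psi] at this
      simp only [zero_add, Nat.cast_zero, add_zero, zero_div] at this
      rw [Nat.cast_succ, add_comm (i:ℝ) 1]
      exact this
    have h3 : ∑ i ∈ Finset.range L, EE L A n (f ∘ Psi L (i, 0)) ≤ EE L A (n+1) f := by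
      simp only [EE]
      have hinj : Function.Injective (fun i : ℕ => (i, (0:ℕ))) := fun a b hab => by
        simpa using hab
      rw [← Finset.sum_image (f := fun a => EE L A n (f ∘ Psi L a)) (g := fun i : ℕ => (i, (0:ℕ)))
        hinj.injOn]
      refine Finset.sum_le_sum_of_subset_of_nonneg ?_ fun a _ _ => EE_nonneg _ _ _ _
      intro a ha
      obtain ⟨i, hi, rfl⟩ := Finset.mem_image.1 ha
      exact h.flat_border _ _ (Finset.mem_range.1 hi) (by omega) (by simp)
    have h4 := sq_sum_le_card_mul_sum_sq (s := Finset.range L)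
      (f := fun i : ℕ => f ((i:ℝ) / L, 0) - f (((i + 1 : ℕ):ℝ) / L, 0))
    rw [← h1, Finset.card_range] at h4
    have h5 := Finset.sum_le_sum h2
    rw [← Finset.mul_sum] at h5
    calc _ ≤ _ := h4
      _ ≤ (L:ℝ) * ((L:ℝ) ^ n * EE L A (n+1) f) := by
        refine mul_le_mul_of_nonneg_left (h5.trans ?_) (Nat.cast_nonneg _)
        exact mul_le_mul_of_nonneg_left h3 (by positivity)
      _ = _ := by ring

lemma cp_pos {L : ℕ} {A : Finset (ℕ × ℕ)} (h : GoodCarpet L A) (n : ℕ) : 0 < cp L A n := by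
  have hL3 := h.three_le
  have hL : (0:ℝ) < L := by exact_mod_cast (by omega : 0 < L)
  have hp : 0 < (L:ℝ) ^ n * 32 := by positivity
  refine lt_of_lt_of_le (inv_pos.2 hp) (le_cc _ _ _ _ _ disj1 _ fun f h1 h2 => ?_)
  have := EE_path h n f
  rw [h1 _ rfl, h2 _ rfl] at this
  have h3 := mul_le_mul_of_nonneg_left (E_le_D h n f) (by positivity : (0:ℝ) ≤ (L:ℝ) ^ n)
  rw [inv_le_iff_one_le_mul₀ hp]
  linarith

lemma cp_edge {L : ℕ} {A : Finset (ℕ × ℕ)} (h : GoodCarpet L A) (k : ℕ) (f : ℝ × ℝ → ℝ) :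
    cp L A k * (f (0,0) - f (1,0)) ^ 2 ≤ EE L A k f := by
  by_cases hd : f (0,0) - f (1,0) = 0
  · rw [hd]; simpa using EE_nonneg L A k f
  have h1 : cp L A k ≤ Dform L A k (fun x => (f x - f (1,0)) / (f (0,0) - f (1,0))) := by
    refine cc_le _ _ _ _ _ _ ?_ ?_
    · rintro x rfl; exact div_self hd
    · rintro x rfl; simp
  have h2 := h1.trans (D_le_E h _ _)
  have h3 := EE_dom h (((f (0,0) - f (1,0)) ^ 2)⁻¹ / 2) k
    (fun x => (f x - f (1,0)) / (f (0,0) - f (1,0))) f f (by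
      intro x _ y _
      refine le_of_eq ?_
      field_simp
      ring)
  have h4 := h2.trans h3
  have hpos : 0 < (f (0,0) - f (1,0)) ^ 2 := by positivity
  calc _ ≤ _ := mul_le_mul_of_nonneg_right h4 hpos.le
    _ = _ := by field_simp; ring

lemma cp_e0 {L : ℕ} {A : Finset (ℕ × ℕ)} (h : GoodCarpet L A) (k : ℕ) (f : ℝ × ℝ → ℝ) :
    cp L A k * e0 f ≤ 8 * EE L A k f := by
  have h1 := cp_edge h k f
  have h2 := cp_edge h k (f ∘ Prod.swap)
  have h3 := cp_edge h k (f ∘ refl2)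
  have h4 := cp_edge h k ((f ∘ refl1) ∘ Prod.swap)
  rw [EE_swap h] at h2
  rw [EE_refl2 h] at h3
  rw [EE_swap h, EE_refl1 h] at h4
  simp only [Function.comp, refl1, refl2, Prod.swap, sub_zero, sub_self] at h1 h2 h3 h4
  unfold e0
  nlinarith

lemma EE_mul {L : ℕ} {A : Finset (ℕ × ℕ)} (h : GoodCarpet L A) (k n : ℕ) (f : ℝ × ℝ → ℝ) :
    cp L A k * EE L A n f ≤ 8 * EE L A (k + n) f := by
  induction n generalizing f with
  | zero => exact cp_e0 h k f
  | succ n ih =>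
    show _ ≤ 8 * EE L A (k + n + 1) f
    simp only [EE]
    rw [Finset.mul_sum, Finset.mul_sum]
    exact Finset.sum_le_sum fun a _ => ih _

lemma cp_super {L : ℕ} {A : Finset (ℕ × ℕ)} (h : GoodCarpet L A) (k n : ℕ) :
    cp L A n * cp L A k ≤ 256 * cp L A (k + n) := by
  have : cp L A n * cp L A k / 256 ≤ cp L A (k + n) := by
    refine le_cc _ _ _ _ _ disj1 _ fun f h1 h2 => ?_
    have a1 : cp L A n ≤ EE L A n f := (cc_le _ _ _ _ _ f h1 h2).trans (D_le_E h n f)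
    have a2 := EE_mul h k n f
    have a3 := E_le_D h (k + n) f
    have a4 := mul_le_mul_of_nonneg_right a1 (cp_pos h k).le
    linarith
  linarith

/-- Bilinear interpolation of the corner values of `f` using a profile `u`. -/
noncomputable def Bil (u f : ℝ × ℝ → ℝ) (s t : ℝ) : ℝ :=
  u (s,t) * u (t,s) * f (0,0) + u (s,t) * (1 - u (t,s)) * f (0,1)
    + (1 - u (s,t)) * u (t,s) * f (1,0) + (1 - u (s,t)) * (1 - u (t,s)) * f (1,1)

/-- Properties of the profile. -/
structure Prof (u : ℝ × ℝ → ℝ) : Prop where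
  left : ∀ t, u (0,t) = 1
  right : ∀ t, u (1,t) = 0
  per : ∀ s, u (s,1) = u (s,0)
  nn : ∀ x, 0 ≤ u x
  le : ∀ x, u x ≤ 1

lemma conv_sq (c : ℝ) (h0 : 0 ≤ c) (h1 : c ≤ 1) (x y : ℝ) :
    (c * x + (1 - c) * y) ^ 2 ≤ x ^ 2 + y ^ 2 := by
  have e1 : 0 ≤ c * (1 - c) * (x - y) ^ 2 :=
    mul_nonneg (mul_nonneg h0 (by linarith)) (sq_nonneg _)
  have e2 : 0 ≤ (1 - c) * x ^ 2 := mul_nonneg (by linarith) (sq_nonneg _)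
  have e3 : 0 ≤ c * y ^ 2 := mul_nonneg h0 (sq_nonneg _)
  linarith

lemma two_sq (x y P Q S : ℝ) (hP : P ^ 2 ≤ S) (hQ : Q ^ 2 ≤ S) :
    (x * P + y * Q) ^ 2 ≤ 2 * S * (x ^ 2 + y ^ 2) := by
  have q1 := mul_le_mul_of_nonneg_left hP (sq_nonneg x)
  have q2 := mul_le_mul_of_nonneg_left hQ (sq_nonneg y)
  have q3 := sq_nonneg (x * P - y * Q)
  linarith

lemma bil_alg (a b a' b' f00 f10 f01 f11 : ℝ) (p1 : 0 ≤ b) (p2 : b ≤ 1) (p3 : 0 ≤ a')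
    (p4 : a' ≤ 1) :
    (a * b * f00 + a * (1 - b) * f01 + (1 - a) * b * f10 + (1 - a) * (1 - b) * f11 -
      (a' * b' * f00 + a' * (1 - b') * f01 + (1 - a') * b' * f10 + (1 - a') * (1 - b') * f11)) ^ 2
    ≤ 3 * (2 * ((f00 - f10) ^ 2 + (f10 - f11) ^ 2 + (f11 - f01) ^ 2 + (f01 - f00) ^ 2)) *
      ((a - a') ^ 2 + (b - b') ^ 2) := by
  have kP := conv_sq b p1 p2 (f00 - f10) (f01 - f11)
  have kQ := conv_sq a' p3 p4 (f00 - f01) (f10 - f11)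
  have e : a * b * f00 + a * (1 - b) * f01 + (1 - a) * b * f10 + (1 - a) * (1 - b) * f11 -
      (a' * b' * f00 + a' * (1 - b') * f01 + (1 - a') * b' * f10 + (1 - a') * (1 - b') * f11)
      = (a - a') * (b * (f00 - f10) + (1 - b) * (f01 - f11))
        + (b - b') * (a' * (f00 - f01) + (1 - a') * (f10 - f11)) := by ring
  rw [e]
  obtain ⟨S, hS⟩ : ∃ S, S = (f00 - f10) ^ 2 + (f10 - f11) ^ 2 + (f11 - f01) ^ 2 + (f01 - f00) ^ 2 :=
    ⟨_, rfl⟩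
  rw [← hS]
  have hS0 : 0 ≤ S := by rw [hS]; positivity
  have r1 : (f01 - f11) ^ 2 = (f11 - f01) ^ 2 := by ring
  have r2 : (f00 - f01) ^ 2 = (f01 - f00) ^ 2 := by ring
  rw [r1] at kP
  rw [r2] at kQ
  have kP' : (b * (f00 - f10) + (1 - b) * (f01 - f11)) ^ 2 ≤ S := by
    refine kP.trans ?_
    have := sq_nonneg (f10 - f11)
    have := sq_nonneg (f01 - f00)
    rw [hS]; linarith
  have kQ' : (a' * (f00 - f01) + (1 - a') * (f10 - f11)) ^ 2 ≤ S := by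
    refine kQ.trans ?_
    have := sq_nonneg (f00 - f10)
    have := sq_nonneg (f11 - f01)
    rw [hS]; linarith
  refine (two_sq _ _ _ _ S kP' kQ').trans ?_
  refine mul_le_mul_of_nonneg_right (by linarith) (by positivity)

lemma Bil_energy {L : ℕ} {A : Finset (ℕ × ℕ)} (h : GoodCarpet L A) (k : ℕ) (u f g : ℝ × ℝ → ℝ)
    (hu : Prof u) (hg : ∀ x ∈ Sq, g x = Bil u f x.1 x.2) :
    EE L A k g ≤ 6 * EE L A k u * e0 f := by
  have := EE_dom h (3 * e0 f) k g u (u ∘ Prod.swap) (by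
    rintro ⟨s, t⟩ hx ⟨s', t'⟩ hy
    rw [hg _ hx, hg _ hy]
    simp only [Bil, Function.comp, Prod.swap]
    have p1 := hu.nn (t,s)
    have p2 := hu.le (t,s)
    have p3 := hu.nn (s',t')
    have p4 := hu.le (s',t')
    generalize u (s,t) = a at *
    generalize u (t,s) = b at *
    generalize u (s',t') = a' at *
    generalize u (t',s') = b' at *
    unfold e0
    generalize f (0,0) = f00 at *
    generalize f (1,0) = f10 at *
    generalize f (0,1) = f01 at *
    generalize f (1,1) = f11 at *
    exact bil_alg a b a' b' f00 f10 f01 f11 p1 p2 p3 p4)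
  rw [EE_swap h] at this
  linarith

/-- Glued function. -/
noncomputable def Glue (u f : ℝ × ℝ → ℝ) (N : ℝ) (z : ℝ × ℝ) : ℝ :=
  Bil u (fun p => f ((p.1 + (⌊N * z.1⌋ : ℝ)) / N, (p.2 + (⌊N * z.2⌋ : ℝ)) / N))
    (Int.fract (N * z.1)) (Int.fract (N * z.2))

lemma floor_aux (i : ℕ) (s : ℝ) (h0 : 0 ≤ s) (h1 : s ≤ 1) :
    (s = 1 ∧ ⌊s + i⌋ = i + 1 ∧ Int.fract (s + i) = 0) ∨ (⌊s + i⌋ = i ∧ Int.fract (s + i) = s) := by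
  rcases h1.lt_or_eq with h1 | rfl
  · right
    have : ⌊s⌋ = 0 := by rw [Int.floor_eq_zero_iff]; exact ⟨h0, h1⟩
    refine ⟨by simp [this], by simp [Int.fract, this]⟩
  · left
    refine ⟨rfl, by simp [add_comm], by simp⟩

lemma Glue_cell (u f : ℝ × ℝ → ℝ) (hu : Prof u) (N : ℝ) (hN : N ≠ 0) (i j : ℕ) (x : ℝ × ℝ)
    (hx : x ∈ Sq) :
    Glue u f N ((x.1 + i) / N, (x.2 + j) / N) =
      Bil u (fun p => f ((p.1 + i) / N, (p.2 + j) / N)) x.1 x.2 := by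
  obtain ⟨s, t⟩ := x
  obtain ⟨⟨s0, s1⟩, ⟨t0, t1⟩⟩ := hx
  simp only at s0 s1 t0 t1
  unfold Glue
  simp only [mul_div_cancel₀ _ hN]
  rcases floor_aux i s s0 s1 with ⟨rfl, h2, h3⟩ | ⟨h2, h3⟩ <;>
  rcases floor_aux j t t0 t1 with ⟨rfl, h2', h3'⟩ | ⟨h2', h3'⟩ <;>
  rw [h2, h2', h3, h3'] <;>
  simp [Bil, hu.left, hu.right, hu.per, add_comm]

lemma Glue_energy {L : ℕ} {A : Finset (ℕ × ℕ)} (h : GoodCarpet L A) (k : ℕ) (u f : ℝ × ℝ → ℝ)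
    (hu : Prof u) (N : ℕ) (n M i j : ℕ) (hM : M * L ^ n = N) (hM0 : M ≠ 0) :
    EE L A (k + n) (fun x => Glue u f N ((x.1 + i) / M, (x.2 + j) / M)) ≤
      6 * EE L A k u * EE L A n (fun x => f ((x.1 + i) / M, (x.2 + j) / M)) := by
  have hL3 := h.three_le
  have hL : (L:ℝ) ≠ 0 := by exact_mod_cast (by omega : L ≠ 0)
  induction n generalizing M i j with
  | zero =>
    simp only [pow_zero, mul_one] at hM
    subst hM
    exact Bil_energy h k u _ _ hu fun x hx => Glue_cell u f hu M (by exact_mod_cast hM0) i j x hx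
  | succ n ih =>
    show EE L A (k + n + 1) _ ≤ _
    have hMr : (M:ℝ) ≠ 0 := by exact_mod_cast hM0
    simp only [EE]
    rw [Finset.mul_sum]
    refine Finset.sum_le_sum fun a _ => ?_
    have := ih (M * L) (L * i + a.1) (L * j + a.2) (by rw [← hM]; ring)
      (Nat.mul_ne_zero hM0 (by omega))
    have e : ∀ (c i : ℕ) (x : ℝ), (x + ((L * i + c : ℕ) : ℝ)) / ((M * L : ℕ) : ℝ) =
        ((x + c) / L + i) / M := by
      intro c i x
      push_cast
      field_simp
      ring
    simp only [e] at this
    exact this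

lemma exists_prof {L : ℕ} {A : Finset (ℕ × ℕ)} (h : GoodCarpet L A) (k : ℕ) (f : ℝ × ℝ → ℝ)
    (h1 : ∀ x ∈ ((VN L A k : Set (ℝ × ℝ)) ∩ ({(0 : ℝ)} ×ˢ Set.Icc (0 : ℝ) 1)), f x = 1)
    (h2 : ∀ x ∈ ((VN L A k : Set (ℝ × ℝ)) ∩ ({(1 : ℝ)} ×ˢ Set.Icc (0 : ℝ) 1)), f x = 0) :
    ∃ u, Prof u ∧ EE L A k u ≤ 32 * Dform L A k f := by
  set g : ℝ × ℝ → ℝ := fun x => if x.1 = 0 then 1 else if x.1 = 1 then 0 else f x with hg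
  have hgf : Dform L A k g = Dform L A k f := by
    refine D_congr _ _ _ _ _ fun x hx => ?_
    have hs := VN_sub_Sq h k x hx
    simp only [hg]
    split_ifs with a b
    · exact (h1 x ⟨hx, a, hs.2⟩).symm
    · exact (h2 x ⟨hx, b, hs.2⟩).symm
    · rfl
  refine ⟨fun x => max 0 (min 1 ((g x + g (refl2 x)) / 2)), ⟨?_, ?_, ?_, ?_, ?_⟩, ?_⟩
  · intro t; simp [hg, refl2]
  · intro t; simp [hg, refl2]
  · intro s; simp [refl2, add_comm]
  · intro x; exact le_max_left _ _
  · intro x; exact max_le zero_le_one (min_le_left _ _)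
  · have := EE_dom h (1/2) k (fun x => max 0 (min 1 ((g x + g (refl2 x)) / 2))) g (g ∘ refl2) (by
      intro x _ y _
      have h3 : |max 0 (min 1 ((g x + g (refl2 x)) / 2)) - max 0 (min 1 ((g y + g (refl2 y)) / 2))|
          ≤ |(g x + g (refl2 x)) / 2 - (g y + g (refl2 y)) / 2| := by
        refine (abs_max_sub_max_le_max _ _ _ _).trans ?_
        simp only [sub_self, abs_zero]
        refine max_le (abs_nonneg _) ((abs_min_sub_min_le_max _ _ _ _).trans ?_)
        simp
      have h4 := sq_le_sq.2 h3
      refine h4.trans ?_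
      simp only [Function.comp]
      nlinarith [sq_nonneg ((g x - g y) - (g (refl2 x) - g (refl2 y)))])
    rw [EE_refl2 h] at this
    have h5 := E_le_D h k g
    rw [hgf] at h5
    linarith

lemma cp_sub_aux {L : ℕ} {A : Finset (ℕ × ℕ)} (h : GoodCarpet L A) (k n : ℕ) (u f : ℝ × ℝ → ℝ)
    (hu : Prof u) (h1 : f (0,0) = 1) (h2 : f (1,0) = 0) :
    cp L A (k + n) ≤ 6 * EE L A k u * EE L A n f := by
  have hL3 := h.three_le
  have hL : (L:ℝ) ≠ 0 := by exact_mod_cast (by omega : L ≠ 0)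
  have hLn : (L:ℝ) ^ n ≠ 0 := pow_ne_zero _ hL
  have key := Glue_energy h k u f hu (L ^ n) n 1 0 0 (by simp) one_ne_zero
  simp only [Nat.cast_zero, add_zero, Nat.cast_one, div_one] at key
  refine le_trans ?_ key
  refine (cc_le _ _ _ _ _ (fun x => Glue u f (L ^ n : ℕ) (x.1, x.2)) ?_ ?_).trans (D_le_E h _ _)
  · rintro x rfl
    simp [Glue, Bil, hu.left, h1]
  · rintro x rfl
    have : ⌊(L:ℝ) ^ n⌋ = (L:ℤ) ^ n := by
      rw [Int.floor_eq_iff]; push_cast; constructor <;> linarith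
    have h' : Int.fract ((L:ℝ) ^ n) = 0 := by
      rw [Int.fract, this]; push_cast; ring
    simp [Glue, Bil, this, h', hu.left, h2, hLn]

lemma cp_sub {L : ℕ} {A : Finset (ℕ × ℕ)} (h : GoodCarpet L A) (k n : ℕ) :
    cp L A (k + n) ≤ 6144 * (cp L A n * cb L A k) := by
  have hm := cp_pos h (k + n)
  have hn := cp_pos h n
  have s1 : ∀ f v : ℝ × ℝ → ℝ, f (0,0) = 1 → f (1,0) = 0 →
      (∀ x ∈ ((VN L A k : Set (ℝ × ℝ)) ∩ ({(0 : ℝ)} ×ˢ Set.Icc (0 : ℝ) 1)), v x = 1) →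
      (∀ x ∈ ((VN L A k : Set (ℝ × ℝ)) ∩ ({(1 : ℝ)} ×ˢ Set.Icc (0 : ℝ) 1)), v x = 0) →
      cp L A (k + n) ≤ 6144 * (Dform L A n f * Dform L A k v) := by
    intro f v f0 f1 v0 v1
    obtain ⟨u, hu, hE⟩ := exists_prof h k v v0 v1
    refine (cp_sub_aux h k n u f hu f0 f1).trans ?_
    have := mul_le_mul hE (E_le_D h n f) (EE_nonneg _ _ _ _)
      (mul_nonneg (by norm_num) (D_nonneg _ _ _ _))
    linarith
  have s2 : ∀ f : ℝ × ℝ → ℝ, f (0,0) = 1 → f (1,0) = 0 →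
      cp L A (k + n) / (6144 * Dform L A n f) ≤ cb L A k := by
    intro f f0 f1
    have hD : 0 < Dform L A n f :=
      hn.trans_le (cc_le _ _ _ _ _ f (by rintro x rfl; exact f0) (by rintro x rfl; exact f1))
    refine le_cc _ _ _ _ _ (disj2 _) _ fun v v0 v1 => ?_
    rw [div_le_iff₀ (by positivity)]
    have := s1 f v f0 f1 v0 v1
    linarith
  have s3 : ∀ f : ℝ × ℝ → ℝ, f (0,0) = 1 → f (1,0) = 0 →
      0 < cb L A k ∧ cp L A (k + n) / (6144 * cb L A k) ≤ Dform L A n f := by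
    intro f f0 f1
    have hD : 0 < Dform L A n f :=
      hn.trans_le (cc_le _ _ _ _ _ f (by rintro x rfl; exact f0) (by rintro x rfl; exact f1))
    have h5 := s2 f f0 f1
    have hb : 0 < cb L A k := lt_of_lt_of_le (by positivity) h5
    refine ⟨hb, ?_⟩
    rw [div_le_iff₀ (by positivity)] at h5 ⊢
    linarith
  have hb : 0 < cb L A k := (s3 (fun x => if x = (0,0) then 1 else 0) (by simp) (by simp)).1
  have s4 : cp L A (k + n) / (6144 * cb L A k) ≤ cp L A n :=
    le_cc _ _ _ _ _ disj1 _ fun f f0 f1 => (s3 f (f0 _ rfl) (f1 _ rfl)).2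
  rw [div_le_iff₀ (by positivity)] at s4
  linarith

/-- Corollary 3.5, planar case: weak multiplicative estimate
for the resistance sequence. -/
theorem weak_multiplicative (L : ℕ) (A : Finset (ℕ × ℕ)) (h : GoodCarpet L A) :
    ∃ c : ℝ, 1 ≤ c ∧ ∀ n m : ℕ, n ≤ m →
      c⁻¹ * (RR L A n * RRbar L A (m - n)) ≤ RR L A m ∧
      RR L A m ≤ c * (RR L A n * RR L A (m - n)) := by
  refine ⟨6144, by norm_num, fun n m hnm => ?_⟩
  obtain ⟨k, rfl⟩ := Nat.exists_eq_add_of_le' hnm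
  rw [Nat.add_sub_cancel]
  have e1 : ∀ n, RR L A n = (cp L A n)⁻¹ := fun n => rfl
  have e2 : ∀ n, RRbar L A n = (cb L A n)⁻¹ := fun n => rfl
  rw [e1, e1, e1, e2]
  have hm := cp_pos h (k + n)
  have hn := cp_pos h n
  have hk := cp_pos h k
  constructor
  · have := inv_anti₀ hm (cp_sub h k n)
    rwa [mul_inv, mul_inv] at this
  · rw [← mul_inv, ← div_eq_mul_inv, inv_le_comm₀ hm (by positivity), inv_div,
      div_le_iff₀ (by norm_num)]
    have := cp_super h k n
    linarith


end Carpet
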